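/- Let F be an SWF on a domain D ∈ 𝒟^PT satisfying unanimity and IIA, and let G ⊆ N be any coalition. Then G is almost-decisive w.r.t. F, or N \ G is almost-decisive w.r.t. F. -/

import Mathlib

open Set
namespace ArrowSC

/-- A profile assigns to each voter a binary relation (their preference) on alternatives. -/
abbrev Profile (n : ℕ) (X : Type*) := Fin n → X → X → Prop

/-- `r` is a strict total order. -/
def IsSTO {X : Type*} (r : X → X → Prop) : Prop :=
  (∀ x, ¬ r x x) ∧ (∀ x y z, r x y → r y z → r x z) ∧
  (∀ x y, x ≠ y → r x y ∨ r y x)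

/-- A genuine profile: every voter's relation is a strict total order, i.e. a member of W(X)^n. -/
def IsProfile {n : ℕ} {X : Type*} (P : Profile n X) : Prop := ∀ i, IsSTO (P i)

/-- A domain: a nonempty set of profiles, each a member of W(X)^n. -/
def IsDomain {n : ℕ} {X : Type*} (D : Set (Profile n X)) : Prop :=
  D.Nonempty ∧ ∀ P ∈ D, IsProfile P

/-- `F` is a social welfare function on `D`: it sends each profile in `D` to a strict total order. -/
def IsSWF {n : ℕ} {X : Type*} (D : Set (Profile n X))
    (F : Profile n X → X → X → Prop) : Prop :=
  ∀ P ∈ D, IsSTO (F P)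

def Unanimity {n : ℕ} {X : Type*} (D : Set (Profile n X))
    (F : Profile n X → X → X → Prop) : Prop :=
  ∀ P ∈ D, ∀ a b : X, (∀ i, P i a b) → F P a b

def IIA {n : ℕ} {X : Type*} (D : Set (Profile n X))
    (F : Profile n X → X → X → Prop) : Prop :=
  ∀ P ∈ D, ∀ P' ∈ D, ∀ a b : X, (∀ i, P i a b ↔ P' i a b) → (F P a b ↔ F P' a b)

def IsDictator {n : ℕ} {X : Type*} (D : Set (Profile n X))
    (F : Profile n X → X → X → Prop) (d : Fin n) : Prop :=
  ∀ P ∈ D, ∀ a b : X, P d a b → F P a b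

def Dictatorial {n : ℕ} {X : Type*} (D : Set (Profile n X))
    (F : Profile n X → X → X → Prop) : Prop :=
  ∃ d, IsDictator D F d

/-- Coalition `G` is almost-decisive over the ordered pair `(a, b)` w.r.t. `F`. -/
def AlmostDecisivePair {n : ℕ} {X : Type*} (D : Set (Profile n X))
    (F : Profile n X → X → X → Prop) (G : Set (Fin n)) (a b : X) : Prop :=
  ∀ P ∈ D, (∀ i, P i a b ↔ i ∈ G) → F P a b

/-- Coalition `G` is almost-decisive over `Y` w.r.t. `F`. -/
def AlmostDecisiveOn {n : ℕ} {X : Type*} (D : Set (Profile n X))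
    (F : Profile n X → X → X → Prop) (G : Set (Fin n)) (Y : Set X) : Prop :=
  ∀ a ∈ Y, ∀ b ∈ Y, a ≠ b → AlmostDecisivePair D F G a b

/-- Coalition `G` is almost-decisive (over all of X) w.r.t. `F`. -/
def AlmostDecisive {n : ℕ} {X : Type*} (D : Set (Profile n X))
    (F : Profile n X → X → X → Prop) (G : Set (Fin n)) : Prop :=
  ∀ a b : X, a ≠ b → AlmostDecisivePair D F G a b

/-- The restriction of `r` to the triple `{a,b,c}` is the order `a` above `b` above `c`. -/
def RanksTriple {X : Type*} (r : X → X → Prop) (a b c : X) : Prop :=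
  r a b ∧ r b c ∧ r a c

/-- The polarized profile `(G : abc, Gᶜ : a'b'c')` on a triple is a subprofile of `D`,
i.e. it belongs to the restriction `D|_{triple}`. -/
def HasPolarizedSubprofile {n : ℕ} {X : Type*} (D : Set (Profile n X)) (G : Set (Fin n))
    (a b c a' b' c' : X) : Prop :=
  ∃ P ∈ D, ∀ i, (i ∈ G → RanksTriple (P i) a b c) ∧ (i ∉ G → RanksTriple (P i) a' b' c')

/-- `D_1(G, {a,b,c}) ⊆ D|_{{a,b,c}}`. -/
def D1sub {n : ℕ} {X : Type*} (D : Set (Profile n X)) (G : Set (Fin n)) (a b c : X) : Prop :=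
  HasPolarizedSubprofile D G b c a a b c ∧
  HasPolarizedSubprofile D G b a c a c b ∧
  HasPolarizedSubprofile D G a b c c a b ∧
  HasPolarizedSubprofile D G a c b c b a ∧
  HasPolarizedSubprofile D G c a b b c a ∧
  HasPolarizedSubprofile D G c b a b a c

/-- `D_2(G, {a,b,c}) ⊆ D|_{{a,b,c}}`. -/
def D2sub {n : ℕ} {X : Type*} (D : Set (Profile n X)) (G : Set (Fin n)) (a b c : X) : Prop :=
  HasPolarizedSubprofile D G a b c b c a ∧
  HasPolarizedSubprofile D G a c b b a c ∧
  HasPolarizedSubprofile D G c a b a b c ∧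
  HasPolarizedSubprofile D G c b a a c b ∧
  HasPolarizedSubprofile D G b c a c a b ∧
  HasPolarizedSubprofile D G b a c c b a

/-- The class 𝒟^PT of polarization over triples. -/
def ClassPT {n : ℕ} {X : Type*} (D : Set (Profile n X)) : Prop :=
  ∀ G : Set (Fin n), G ≠ ∅ → G ≠ univ →
    ∀ a b c : X, a ≠ b → b ≠ c → a ≠ c →
      D1sub D G a b c ∨ D2sub D G a b c

/-- The class 𝒟^DT of diversity over triples. -/
def ClassDT {n : ℕ} {X : Type*} (D : Set (Profile n X)) : Prop :=
  ∀ G G' : Set (Fin n), ¬ G ⊆ G' → ¬ G' ⊆ G →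
    ∃ a b c : X, a ≠ b ∧ b ≠ c ∧ a ≠ c ∧ ∃ P ∈ D, ∀ i,
      (P i a b ↔ i ∈ G) ∧ (P i b c ↔ i ∈ G') ∧ (P i c a ↔ i ∉ G ∩ G')

/-- `D` is Arrow-inconsistent. -/
def ArrowInconsistent {n : ℕ} {X : Type*} (D : Set (Profile n X)) : Prop :=
  ∀ F : Profile n X → X → X → Prop,
    IsSWF D F → Unanimity D F → IIA D F → Dictatorial D F

/-- `a` is the most-preferred among `{a,b,c}` according to `r`. -/
def TripleBest {X : Type*} (r : X → X → Prop) (a b c : X) : Prop := r a b ∧ r a c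

/-- `a` is the least-preferred among `{a,b,c}` according to `r`. -/
def TripleWorst {X : Type*} (r : X → X → Prop) (a b c : X) : Prop := r b a ∧ r c a

/-- `a` is the middle-preferred among `{a,b,c}` according to `r`. -/
def TripleMiddle {X : Type*} (r : X → X → Prop) (a b c : X) : Prop :=
  (r b a ∧ r a c) ∨ (r c a ∧ r a b)

/-- In profile `P`, alternative `a` is never placed as the most-preferred, or never as the
middle-preferred, or never as the least-preferred alternative among `{a,b,c}`. -/
def NeverBMW {n : ℕ} {X : Type*} (P : Profile n X) (a b c : X) : Prop :=
  (∀ i, ¬ TripleBest (P i) a b c) ∨ (∀ i, ¬ TripleMiddle (P i) a b c) ∨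
  (∀ i, ¬ TripleWorst (P i) a b c)

/-- Sen's value-restriction of a profile over `Y`. -/
def ValueRestricted {n : ℕ} {X : Type*} (P : Profile n X) (Y : Set X) : Prop :=
  ∀ a ∈ Y, ∀ b ∈ Y, ∀ c ∈ Y, a ≠ b → b ≠ c → a ≠ c →
    NeverBMW P a b c ∨ NeverBMW P b a c ∨ NeverBMW P c a b

/-- The strict total order on the triple `{a,b,c}` ranking `a` above `b` above `c`,
viewed as a relation with support in `{a,b,c}`. -/
def seqOrder {X : Type*} (a b c : X) : X → X → Prop :=
  fun x y => (x = a ∧ y = b) ∨ (x = b ∧ y = c) ∨ (x = a ∧ y = c)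

/-- `r` is a strict total order on the triple `{a,b,c}` (with support in the triple). -/
def IsTripleOrder {X : Type*} (a b c : X) (r : X → X → Prop) : Prop :=
  (∀ x y, r x y → x ∈ ({a, b, c} : Set X) ∧ y ∈ ({a, b, c} : Set X)) ∧
  (∀ x, ¬ r x x) ∧ (∀ x y z, r x y → r y z → r x z) ∧
  (∀ x ∈ ({a, b, c} : Set X), ∀ y ∈ ({a, b, c} : Set X), x ≠ y → r x y ∨ r y x)

/-- The polarized profile `(G : Q, Gᶜ : Q')`. -/
def polarizedProfile {n : ℕ} {X : Type*} (G : Set (Fin n)) (Q Q' : X → X → Prop) :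
    Profile n X :=
  fun i x y => (i ∈ G ∧ Q x y) ∨ (i ∉ G ∧ Q' x y)

/-- `Q` and `Q'` differ on how they rank the pair `{x, y}`. -/
def DifferOn {X : Type*} (Q Q' : X → X → Prop) (x y : X) : Prop := ¬ (Q x y ↔ Q' x y)

/-- `Q` and `Q'` differ on exactly two of the three unordered pairs of the triple `{a,b,c}`
and coincide on the remaining pair. -/
def StronglyPolarizedPair {X : Type*} (a b c : X) (Q Q' : X → X → Prop) : Prop :=
  (DifferOn Q Q' a b ∧ DifferOn Q Q' b c ∧ ¬ DifferOn Q Q' a c) ∨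
  (DifferOn Q Q' a b ∧ ¬ DifferOn Q Q' b c ∧ DifferOn Q Q' a c) ∨
  (¬ DifferOn Q Q' a b ∧ DifferOn Q Q' b c ∧ DifferOn Q Q' a c)

/-- The set `D_1(G, {a,b,c})` of polarized profiles on the triple `{a,b,c}`. -/
def D1set {n : ℕ} {X : Type*} (G : Set (Fin n)) (a b c : X) : Set (Profile n X) :=
  { polarizedProfile G (seqOrder b c a) (seqOrder a b c),
    polarizedProfile G (seqOrder b a c) (seqOrder a c b),
    polarizedProfile G (seqOrder a b c) (seqOrder c a b),
    polarizedProfile G (seqOrder a c b) (seqOrder c b a),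
    polarizedProfile G (seqOrder c a b) (seqOrder b c a),
    polarizedProfile G (seqOrder c b a) (seqOrder b a c) }

/-- The set `D_2(G, {a,b,c})` of polarized profiles on the triple `{a,b,c}`. -/
def D2set {n : ℕ} {X : Type*} (G : Set (Fin n)) (a b c : X) : Set (Profile n X) :=
  { polarizedProfile G (seqOrder a b c) (seqOrder b c a),
    polarizedProfile G (seqOrder a c b) (seqOrder b a c),
    polarizedProfile G (seqOrder c a b) (seqOrder a b c),
    polarizedProfile G (seqOrder c b a) (seqOrder a c b),
    polarizedProfile G (seqOrder b c a) (seqOrder c a b),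
    polarizedProfile G (seqOrder b a c) (seqOrder c b a) }

/-- The set of all strongly polarized profiles on the triple `{a,b,c}`
of the form `(G : Q, Gᶜ : Q')`. -/
def SPset {n : ℕ} {X : Type*} (G : Set (Fin n)) (a b c : X) : Set (Profile n X) :=
  { p | ∃ Q Q', IsTripleOrder a b c Q ∧ IsTripleOrder a b c Q' ∧
      StronglyPolarizedPair a b c Q Q' ∧ p = polarizedProfile G Q Q' }
section

variable {X : Type*} {n : ℕ} {D : Set (Profile n X)} {F : Profile n X → X → X → Prop}
  {G : Set (Fin n)}

theorem IsSTO.asymm {r : X → X → Prop} (h : IsSTO r) {a b : X} (hab : r a b) : ¬ r b a :=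
  fun hba => h.1 a (h.2.1 a b a hab hba)

theorem IsSTO.not_iff {r : X → X → Prop} (h : IsSTO r) {a b : X} (hne : a ≠ b) :
    ¬ r a b ↔ r b a :=
  ⟨fun hn => (h.2.2 a b hne).resolve_left hn, fun hba => h.asymm hba⟩

/-- Under IIA, a single profile in which `G` imposes `a` over `b` makes `G` almost-decisive. -/
theorem IIA.almostDecisivePair (hI : IIA D F) {P : Profile n X} (hP : P ∈ D) {a b : X}
    (h : ∀ i, P i a b ↔ i ∈ G) (hab : F P a b) : AlmostDecisivePair D F G a b :=
  fun P' hP' h' => (hI P hP P' hP' a b fun i => (h i).trans (h' i).symm).1 hab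

theorem almostDecisivePair_univ (hU : Unanimity D F) (a b : X) :
    AlmostDecisivePair D F univ a b :=
  fun P hP h => hU P hP a b fun i => (h i).2 (mem_univ i)

/-- If `G` ranks `xyz` and the others `yzx`, decisiveness passes from `(x, y)` to `(x, z)`. -/
theorem AlmostDecisivePair.trans_right (hD : ∀ P ∈ D, IsProfile P) (hF : IsSWF D F)
    (hU : Unanimity D F) (hI : IIA D F) {x y z : X}
    (hxy : AlmostDecisivePair D F G x y) (h : HasPolarizedSubprofile D G x y z y z x) :
    AlmostDecisivePair D F G x z := by
  obtain ⟨P, hP, h⟩ := h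
  refine hI.almostDecisivePair hP (fun i => ⟨fun hi => ?_, fun hi => ((h i).1 hi).2.2⟩)
    ((hF P hP).2.1 x y z (hxy P hP fun i => ⟨fun hi => ?_, fun hi => ((h i).1 hi).1⟩)
      (hU P hP y z fun i => ?_))
  · by_contra hG
    exact (hD P hP i).asymm hi ((h i).2 hG).2.1
  · by_contra hG
    exact (hD P hP i).asymm hi ((h i).2 hG).2.2
  · by_cases hG : i ∈ G
    · exact ((h i).1 hG).2.1
    · exact ((h i).2 hG).1

/-- If `G` ranks `xyz` and the others `zxy`, decisiveness passes from `(y, z)` to `(x, z)`. -/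
theorem AlmostDecisivePair.trans_left (hD : ∀ P ∈ D, IsProfile P) (hF : IsSWF D F)
    (hU : Unanimity D F) (hI : IIA D F) {x y z : X}
    (hyz : AlmostDecisivePair D F G y z) (h : HasPolarizedSubprofile D G x y z z x y) :
    AlmostDecisivePair D F G x z := by
  obtain ⟨P, hP, h⟩ := h
  refine hI.almostDecisivePair hP (fun i => ⟨fun hi => ?_, fun hi => ((h i).1 hi).2.2⟩)
    ((hF P hP).2.1 x y z (hU P hP x y fun i => ?_)
      (hyz P hP fun i => ⟨fun hi => ?_, fun hi => ((h i).1 hi).2.1⟩))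
  · by_contra hG
    exact (hD P hP i).asymm hi ((h i).2 hG).1
  · by_cases hG : i ∈ G
    · exact ((h i).1 hG).1
    · exact ((h i).2 hG).2.1
  · by_contra hG
    exact (hD P hP i).asymm hi ((h i).2 hG).2.2

/-- On a polarized triple, decisiveness over `(a, b)` spreads to `(a, c)` and `(c, b)`. -/
theorem AlmostDecisivePair.of_polarized (hD : ∀ P ∈ D, IsProfile P) (hF : IsSWF D F)
    (hU : Unanimity D F) (hI : IIA D F) {a b c : X} (hab : AlmostDecisivePair D F G a b)
    (h : D1sub D G a b c ∨ D2sub D G a b c) :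
    AlmostDecisivePair D F G a c ∧ AlmostDecisivePair D F G c b := by
  obtain ⟨h₁, h₂, h₃, -, h₅, h₆⟩ | ⟨h₁, -, h₃, h₄, h₅, h₆⟩ := h
  · have hcb := hab.trans_left hD hF hU hI h₅
    have hba := (hcb.trans_right hD hF hU hI h₆).trans_left hD hF hU hI h₁
    exact ⟨(hba.trans_right hD hF hU hI h₂).trans_left hD hF hU hI h₃, hcb⟩
  · have hac := hab.trans_right hD hF hU hI h₁
    have hba := (hac.trans_left hD hF hU hI h₆).trans_right hD hF hU hI h₅
    exact ⟨hac, (hba.trans_left hD hF hU hI h₄).trans_right hD hF hU hI h₃⟩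

/-- On a domain polarized over triples, decisiveness over one pair spreads to every pair. -/
theorem AlmostDecisivePair.almostDecisive [Fintype X] (hX : 3 ≤ Fintype.card X)
    (hD : ∀ P ∈ D, IsProfile P) (hPT : ClassPT D) (hF : IsSWF D F) (hU : Unanimity D F)
    (hI : IIA D F) (hG : G ≠ ∅) (hG' : G ≠ univ) {a b : X} (hne : a ≠ b)
    (hab : AlmostDecisivePair D F G a b) : AlmostDecisive D F G := by
  have right {x y z : X} (hxy : x ≠ y) (hxz : x ≠ z) (h : AlmostDecisivePair D F G x y) :
      AlmostDecisivePair D F G x z := by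
    by_cases hyz : y = z
    · exact hyz ▸ h
    · exact (h.of_polarized hD hF hU hI (hPT G hG hG' x y z hxy hyz hxz)).1
  have left {x y z : X} (hxy : x ≠ y) (hzy : z ≠ y) (h : AlmostDecisivePair D F G x y) :
      AlmostDecisivePair D F G z y := by
    by_cases hxz : x = z
    · exact hxz ▸ h
    · exact (h.of_polarized hD hF hU hI (hPT G hG hG' x y z hxy hzy.symm hxz)).2
  intro x y hxy
  classical
  obtain ⟨c, hc⟩ : ∃ c, c ∉ ({a, x} : Finset X) := by
    by_contra! h
    have := Finset.card_le_two (a := a) (b := x)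
    rw [Finset.eq_univ_iff_forall.2 h, Finset.card_univ] at this
    omega
  simp only [Finset.mem_insert, Finset.mem_singleton, not_or] at hc
  have hac := right hne (Ne.symm hc.1) hab
  exact right (Ne.symm hc.2) hxy (left (Ne.symm hc.1) (Ne.symm hc.2) hac)

end

/-- for domains in 𝒟^PT, every coalition or its complement is
almost-decisive (third ultrafilter property). -/
theorem almost_decisive_G_or_compl {X : Type*} [Fintype X] {n : ℕ}
    (hX : 3 ≤ Fintype.card X) (hn : 2 ≤ n)
    (D : Set (Profile n X)) (hD : IsDomain D) (hPT : ClassPT D)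
    (F : Profile n X → X → X → Prop) (hF : IsSWF D F)
    (hU : Unanimity D F) (hIIA : IIA D F)
    (G : Set (Fin n)) :
    AlmostDecisive D F G ∨ AlmostDecisive D F Gᶜ := by
  by_cases hG : G = ∅
  · rw [hG, compl_empty]
    exact Or.inr fun a b _ => almostDecisivePair_univ hU a b
  by_cases hG' : G = univ
  · rw [hG']
    exact Or.inl fun a b _ => almostDecisivePair_univ hU a b
  by_contra! h
  obtain ⟨hn, hc⟩ := h
  refine hc fun a b hab P hP hPG => ?_
  by_contra hF_ab
  have hba : ∀ i, P i b a ↔ i ∈ G := fun i => by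
    rw [← (hD.2 P hP i).not_iff hab, hPG i, mem_compl_iff, not_not]
  exact hn ((hIIA.almostDecisivePair hP hba (((hF P hP).not_iff hab).1 hF_ab)).almostDecisive
    hX hD.2 hPT hF hU hIIA hG hG' hab.symm)

end ArrowSC
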